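/- Let p be a prime number with p ≡ 7 (mod 8), set N = 4(p−1), and let F = Φ_p²·Φ_{2p}² ∈ ℤ[X], where Φ_m is the m-th cyclotomic polynomial (so deg F = N). Then there do NOT exist matrices B, T ∈ M_N(ℤ) such that: B is symmetric, every diagonal entry of B is even, xᵀ·B·x > 0 for every nonzero x ∈ ℤ^N, det B = 1, Tᵀ·B·T = B, and the characteristic polynomial of T equals F. In particular, no positive definite even unimodular lattice of rank 4(p−1) has an isometry with characteristic polynomial Φ_p²·Φ_{2p}². -/

import Mathlib

open Polynomial Matrix

open Filter Topology in
theorem tendsto_tsum_of_norm_eq_gaussian {g : ℝ → ℤ → ℂ}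
    (norm_eq : ∀ s, 0 < s → ∀ m : ℤ, ‖g s m‖ = Real.exp (-Real.pi * m ^ 2 / s))
    (zero_eq : ∀ s, 0 < s → g s 0 = 1) :
    Tendsto (fun s => ∑' m, g s m) (𝓝[>] 0) (𝓝 1) := by
  have summable_bound : Summable fun m : ℤ => Real.exp (-Real.pi * (m : ℝ) ^ 2) := by
    simpa using summable_pow_mul_jacobiTheta₂_term_bound 0 one_pos 0
  have limit (m : ℤ) : Tendsto (g · m) (𝓝[>] 0) (𝓝 (if m = 0 then 1 else 0)) := by
    split_ifs with hm
    · subst hm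
      refine tendsto_const_nhds.congr' ?_
      filter_upwards [self_mem_nhdsWithin] with s hs using (zero_eq s hs).symm
    · rw [tendsto_zero_iff_norm_tendsto_zero]
      have main : Tendsto (fun s : ℝ => Real.exp (-(Real.pi * (m : ℝ) ^ 2 * s⁻¹))) (𝓝[>] 0)
          (𝓝 0) :=
        Real.tendsto_exp_neg_atTop_nhds_zero.comp
          (tendsto_inv_nhdsGT_zero.const_mul_atTop (by positivity))
      refine main.congr' ?_
      filter_upwards [self_mem_nhdsWithin] with s hs
      rw [norm_eq s hs]
      ring_nf
  have key := tendsto_tsum_of_dominated_convergence summable_bound limit ?_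
  · simpa using key
  · filter_upwards [Ioo_mem_nhdsGT (zero_lt_one' ℝ)] with s hs m
    rw [norm_eq s hs.1, Real.exp_le_exp, neg_mul, neg_div, neg_le_neg_iff, le_div_iff₀ hs.1]
    exact mul_le_of_le_one_right (by positivity) hs.2.le

theorem summable_cexp_neg_mul_int_sq {z : ℂ} (hz : 0 < z.re) :
    Summable fun k : ℤ => Complex.exp (-Real.pi * z * (k : ℂ) ^ 2) := by
  refine Summable.of_norm ?_
  have := summable_pow_mul_jacobiTheta₂_term_bound 0 hz 0
  refine this.congr fun k => ?_
  rw [Complex.norm_exp]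
  have : ((k : ℂ) ^ 2) = (((k : ℝ) ^ 2 : ℝ) : ℂ) := by push_cast; rfl
  rw [this, Complex.re_mul_ofReal, ← Complex.ofReal_neg, Complex.re_ofReal_mul]
  simp
  ring_nf

open Complex in
/-- Poisson summation in each residue class modulo `N`. -/
theorem tsum_exp_quadratic_phase (N : ℕ) [NeZero N] (hN : Even N) {a : ℂ} (ha : 0 < a.re) :
    ∑' k : ℤ, exp (-Real.pi * (a / N ^ 2 - I / N) * (k : ℂ) ^ 2) =
      1 / a ^ (1 / 2 : ℂ) * ∑ r : Fin N, exp (Real.pi * I * (r : ℂ) ^ 2 / N) *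
        ∑' m : ℤ, exp (-Real.pi / a * (m : ℂ) ^ 2 + 2 * Real.pi * I * m * r / N) := by
  have hN0 : (N : ℂ) ≠ 0 := NeZero.ne _
  have ha0 : a ≠ 0 := by rintro rfl; simp at ha
  have hre : 0 < (a / N ^ 2 - I / N).re := by
    have h1 : (a / N ^ 2).re = a.re / N ^ 2 := by
      rw [show (N : ℂ) ^ 2 = ((N ^ 2 : ℝ) : ℂ) by push_cast; rfl, div_ofReal_re]
    have h2 : (I / N).re = 0 := by
      rw [show (N : ℂ) = ((N : ℝ) : ℂ) by push_cast; rfl, div_ofReal_re]; simp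
    have : (0 : ℝ) < N := by exact_mod_cast Nat.pos_of_neZero N
    rw [sub_re, h1, h2, sub_zero]
    positivity
  have hs := summable_cexp_neg_mul_int_sq hre
  let e : Fin N × ℤ ≃ ℤ := (Equiv.prodComm _ _).trans (Int.divModEquiv N).symm
  have hs' : Summable fun c => exp (-Real.pi * (a / N ^ 2 - I / N) * (e c : ℂ) ^ 2) :=
    e.summable_iff.mpr hs
  rw [← e.tsum_eq, hs'.tsum_prod, tsum_fintype, Finset.mul_sum]
  refine Finset.sum_congr rfl fun r _ => ?_
  obtain ⟨N', hN'⟩ := hN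
  have split (m : ℤ) : exp (-Real.pi * (a / N ^ 2 - I / N) *
        (e (r, m) : ℂ) ^ 2) =
      exp (Real.pi * I * (r : ℂ) ^ 2 / N) * exp (-Real.pi * a * r ^ 2 / N ^ 2) *
        exp (-Real.pi * a * (m : ℂ) ^ 2 + 2 * Real.pi * (-(a * r / N)) * m) := by
    rw [← exp_add, ← exp_add, exp_eq_exp_iff_exists_int]
    refine ⟨m * r + N' * m ^ 2, ?_⟩
    have hN'' : (N' : ℂ) = N / 2 := by rw [hN']; push_cast; ring
    simp only [e, Equiv.trans_apply, Equiv.prodComm_apply, Prod.swap_prod_mk, Int.divModEquiv_symm_apply]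
    push_cast
    rw [hN'']
    field_simp
    ring
  simp_rw [split]
  rw [tsum_mul_left, tsum_exp_neg_quadratic ha]
  have shift (m : ℤ) : exp (-Real.pi / a * ((m : ℂ) + I * (-(a * r / N))) ^ 2) =
      exp (Real.pi * a * r ^ 2 / N ^ 2) *
        exp (-Real.pi / a * (m : ℂ) ^ 2 + 2 * Real.pi * I * m * r / N) := by
    rw [← exp_add]
    congr 1
    field_simp
    ring_nf
    simp only [I_sq]
    ring
  simp_rw [shift]
  rw [tsum_mul_left]
  have cancel : exp (-Real.pi * a * r ^ 2 / N ^ 2) * exp (Real.pi * a * r ^ 2 / N ^ 2) = 1 := by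
    rw [← exp_add, ← exp_zero]
    congr 1
    ring
  linear_combination (1 / a ^ (1 / 2 : ℂ) * exp (Real.pi * I * (r : ℂ) ^ 2 / N) *
        ∑' m : ℤ, exp (-Real.pi / a * (m : ℂ) ^ 2 + 2 * Real.pi * I * m * r / N)) * cancel

open Complex Filter Topology in
/-- The value of the quadratic Gauss sum of even modulus, including its sign. -/
theorem sum_fin_exp_pi_mul_sq_div (N : ℕ) [NeZero N] (hN : Even N) :
    ∑ r : Fin N, exp (Real.pi * I * (r : ℂ) ^ 2 / N) = Real.sqrt N * exp (Real.pi * I / 4) := by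
  have hN0 : (N : ℂ) ≠ 0 := NeZero.ne _
  have hNpos : (0 : ℝ) < N := by exact_mod_cast Nat.pos_of_neZero N
  let u : ℝ → ℂ := fun s => N / (N - I * s)
  let z : ℝ → ℂ := fun s => 1 / (s + I * N)
  let S : ℝ → ℂ := fun s => ∑ r : Fin N, exp (Real.pi * I * (r : ℂ) ^ 2 / N) *
    ∑' m : ℤ, exp (-Real.pi / (s * u s) * (m : ℂ) ^ 2 + 2 * Real.pi * I * m * r / N)
  let A : ℝ → ℂ := fun s => ∑' m : ℤ, exp (-Real.pi / s * (m : ℂ) ^ 2)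
  have hden (s : ℝ) : (N : ℂ) - I * s ≠ 0 := fun h => by
    have := congrArg re h
    simp at this
    exact hN0 (by exact_mod_cast this)
  have hden' (s : ℝ) : (s : ℂ) + I * N ≠ 0 := fun h => by
    have := congrArg im h
    simp at this
    exact hN0 (by exact_mod_cast this)
  have hu (s : ℝ) : u s ≠ 0 := div_ne_zero hN0 (hden s)
  have hure (s : ℝ) : 0 < (u s).re := by
    have : 0 < normSq ((N : ℂ) - I * s) := normSq_pos.mpr (hden s)
    simp only [u, div_re]
    simp
    positivity
  have relation : ∀ s : ℝ, 0 < s → S s = u s ^ (1 / 2 : ℂ) * (1 / z s ^ (1 / 2 : ℂ)) * A s := by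
    intro s hs
    have hs0 : (s : ℂ) ≠ 0 := by exact_mod_cast hs.ne'
    have hz : s * u s / N ^ 2 - I / N = z s := by
      have h1 : (N : ℂ) - s * I ≠ 0 := by simpa only [mul_comm] using hden s
      have h2 : (s : ℂ) + N * I ≠ 0 := by simpa only [mul_comm] using hden' s
      simp only [u, z]
      field_simp
      linear_combination (s ^ 2 - N ^ 2 + s * N * I) * I_sq
    have h1 := tsum_exp_quadratic_phase N hN (a := s * u s)
      (by rw [re_ofReal_mul]; exact mul_pos hs (hure s))
    have hzre : 0 < (z s).re := by
      have : 0 < normSq ((s : ℂ) + I * N) := normSq_pos.mpr (hden' s)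
      simp only [z, div_re]
      simp
      positivity
    have h2 := tsum_exp_neg_mul_int_sq hzre
    have h3 := tsum_exp_neg_mul_int_sq (a := (s : ℂ)) (by simpa using hs)
    have h4 : ∑' n : ℤ, exp (-Real.pi / z s * (n : ℂ) ^ 2) =
        ∑' n : ℤ, exp (-Real.pi * s * (n : ℂ) ^ 2) := by
      refine tsum_congr fun n => ?_
      obtain ⟨N', hN'⟩ := hN
      have hN'' : (N' : ℂ) = N / 2 := by rw [hN']; push_cast; ring
      rw [exp_eq_exp_iff_exists_int]
      refine ⟨-(N' * n ^ 2), ?_⟩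
      push_cast
      rw [hN'']
      simp only [z]
      have h2 := hden' s
      field_simp
      ring
    have hpow : (s * u s : ℂ) ^ (1 / 2 : ℂ) = (s : ℂ) ^ (1 / 2 : ℂ) * u s ^ (1 / 2 : ℂ) := by
      rw [cpow_def_of_ne_zero (mul_ne_zero hs0 (hu s)), log_ofReal_mul hs (hu s), add_mul,
        exp_add, cpow_def_of_ne_zero hs0, cpow_def_of_ne_zero (hu s), ofReal_log hs.le]
    rw [hz, h2, h4, h3, hpow] at h1
    have hs1 : (s : ℂ) ^ (1 / 2 : ℂ) ≠ 0 := by simp [cpow_eq_zero_iff, hs0]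
    have hu1 : u s ^ (1 / 2 : ℂ) ≠ 0 := by simp [cpow_eq_zero_iff, hu s]
    have hS : S s = (s : ℂ) ^ (1 / 2 : ℂ) * u s ^ (1 / 2 : ℂ) *
        (1 / ((s : ℂ) ^ (1 / 2 : ℂ) * u s ^ (1 / 2 : ℂ)) * S s) := by
      field_simp
    rw [hS]
    simp only [S]
    rw [← h1]
    simp only [A]
    field_simp
  have limA : Tendsto A (𝓝[>] 0) (𝓝 1) := by
    refine tendsto_tsum_of_norm_eq_gaussian (fun s hs m => ?_) (fun s hs => by simp)
    rw [norm_exp]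
    congr 1
    have : -(Real.pi : ℂ) / s * (m : ℂ) ^ 2 = ((-Real.pi * m ^ 2 / s : ℝ) : ℂ) := by
      push_cast; ring
    rw [this, ofReal_re]
  have limS : Tendsto S (𝓝[>] 0) (𝓝 (∑ r : Fin N, exp (Real.pi * I * (r : ℂ) ^ 2 / N) * 1)) := by
    refine tendsto_finsetSum _ fun r _ => Tendsto.const_mul _ ?_
    refine tendsto_tsum_of_norm_eq_gaussian (fun s hs m => ?_) (fun s hs => by simp)
    rw [norm_exp]
    congr 1
    have hs0 : (s : ℂ) ≠ 0 := by exact_mod_cast hs.ne'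
    have : -(Real.pi : ℂ) / (s * u s) * (m : ℂ) ^ 2 + 2 * Real.pi * I * m * r / N =
        ((-Real.pi * m ^ 2 / s : ℝ) : ℂ) + ((Real.pi * m ^ 2 / N + 2 * Real.pi * m * r / N : ℝ) : ℂ)
          * I := by
      have h1 := hden s
      simp only [u]
      push_cast
      field_simp
      ring
    rw [this]
    simp only [add_re, ofReal_re, re_ofReal_mul, I_re, mul_zero, add_zero]
  have contu : Tendsto u (𝓝[>] 0) (𝓝 1) := by
    have : ContinuousAt u 0 := by
      refine ContinuousAt.div (by fun_prop) (by fun_prop) (hden 0)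
    have h := this.tendsto
    simp only [u, ofReal_zero, mul_zero, sub_zero, div_self hN0] at h
    exact h.mono_left nhdsWithin_le_nhds
  have contz : Tendsto z (𝓝[>] 0) (𝓝 (1 / (I * N))) := by
    have : ContinuousAt z 0 := by
      refine ContinuousAt.div (by fun_prop) (by fun_prop) (hden' 0)
    have h := this.tendsto
    simp only [z, ofReal_zero, zero_add] at h
    exact h.mono_left nhdsWithin_le_nhds
  have hz0 : (1 / (I * N) : ℂ) = ((N : ℝ)⁻¹ : ℝ) * (-I) := by
    push_cast
    rw [one_div, mul_inv, inv_I]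
    ring
  have powu := (continuousAt_cpow_const (b := 1 / 2) one_mem_slitPlane).tendsto.comp contu
  have powz := (continuousAt_cpow_const (a := 1 / (I * N)) (b := 1 / 2) (by
    rw [hz0, mem_slitPlane_iff]
    right
    rw [im_ofReal_mul]
    simpa using hN0)).tendsto.comp contz
  have hzpow : (1 / (I * N) : ℂ) ^ (1 / 2 : ℂ) = 1 / (Real.sqrt N * exp (Real.pi * I / 4)) := by
    have hinv : (0 : ℝ) < (N : ℝ)⁻¹ := by positivity
    rw [hz0, cpow_def_of_ne_zero (mul_ne_zero (by exact_mod_cast hinv.ne') (by simp)),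
      log_ofReal_mul hinv (by simp), log_neg_I, add_mul, exp_add, one_div (_ * _), mul_inv, ← Complex.exp_neg]
    congr 1
    · rw [Real.log_inv, Real.sqrt_eq_rpow, Real.rpow_def_of_pos hNpos]
      push_cast
      rw [← Complex.exp_neg]
      ring_nf
    · ring_nf
  have limR := (powu.mul ((tendsto_const_nhds (x := (1 : ℂ))).div powz (by
    rw [hzpow]; simp [hNpos.ne']))).mul limA
  have key := tendsto_nhds_unique (limS.congr' (by
    filter_upwards [self_mem_nhdsWithin] with s hs using relation s hs)) limR
  rw [hzpow] at key
  simpa using key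

/-- The Gauss sum of a quadratic function that is trivial on a subgroup equal to its own
orthogonal is the order of this subgroup. -/
theorem sum_quadratic_eq_card {A : Type*} [AddCommGroup A] [Fintype A] (χ : A → ℂ)
    (ψ : A → AddChar A ℂ) (χ_add : ∀ c d, χ (c + d) = χ c * χ d * ψ c d) (H : AddSubgroup A)
    (χ_eq_one : ∀ h ∈ H, χ h = 1) (mem_of_orthogonal : ∀ c, (∀ h ∈ H, ψ c h = 1) → c ∈ H) :
    ∑ c, χ c = Nat.card H := by
  classical
  have inner_sum (c : A) : χ c * ∑ h : H, ψ c h = if c ∈ H then (Nat.card H : ℂ) else 0 := by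
    split_ifs with hc
    · have (h : H) : ψ c h = 1 := by
        have := χ_add c h
        rwa [χ_eq_one _ (H.add_mem hc h.2), χ_eq_one _ hc, χ_eq_one _ h.2, one_mul, one_mul,
          eq_comm] at this
      simp [this, χ_eq_one c hc]
    · have hne : (ψ c).compAddMonoidHom H.subtype ≠ 1 := fun h1 => hc <|
        mem_of_orthogonal c fun h hh => by
          simpa using DFunLike.congr_fun h1 (⟨h, hh⟩ : H)
      have := AddChar.sum_eq_zero_of_ne_one hne
      simp only [AddChar.compAddMonoidHom_apply, AddSubgroup.coe_subtype] at this
      rw [this, mul_zero]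
  have translate (h : H) : ∑ c, χ c = ∑ c, χ c * ψ c h := by
    rw [← Equiv.sum_comp (Equiv.addRight (h : A)) χ]
    refine Finset.sum_congr rfl fun c _ => ?_
    rw [Equiv.coe_addRight, χ_add, χ_eq_one _ h.2, mul_one]
  have total : (Nat.card H : ℂ) * ∑ c, χ c = Nat.card H * Nat.card H := by
    calc (Nat.card H : ℂ) * ∑ c, χ c = ∑ h : H, ∑ c, χ c := by simp
      _ = ∑ h : H, ∑ c, χ c * ψ c h := Finset.sum_congr rfl fun h _ => translate h
      _ = ∑ c, χ c * ∑ h : H, ψ c h := by rw [Finset.sum_comm]; simp_rw [Finset.mul_sum]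
      _ = _ := by
        simp_rw [inner_sum]
        rw [← Finset.sum_filter, Finset.sum_const, nsmul_eq_mul, Nat.card_eq_fintype_card,
          Fintype.card_subtype]
  exact mul_left_cancel₀ (by exact_mod_cast Nat.card_pos.ne') total

/-- The quadratic function `c ↦ exp (π i c² / N)` on `ZMod N`, for even `N`. -/
noncomputable def quadraticPhase (N : ℕ) (c : ZMod N) : ℂ :=
  Complex.exp (Real.pi * Complex.I * (c.val : ℂ) ^ 2 / N)

theorem quadraticPhase_intCast {N : ℕ} [NeZero N] (hN : Even N) (j : ℤ) :
    quadraticPhase N (j : ZMod N) = Complex.exp (Real.pi * Complex.I * (j : ℂ) ^ 2 / N) := by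
  have hN0 : (N : ℂ) ≠ 0 := NeZero.ne _
  obtain ⟨N', hN'⟩ := hN
  obtain ⟨k, hk⟩ : ∃ k : ℤ, ((j : ZMod N).val : ℤ) = j + N * k := by
    refine ⟨-(j / N), ?_⟩
    rw [ZMod.val_intCast, Int.emod_def]
    ring
  have hk' : ((j : ZMod N).val : ℂ) = j + N * k := by exact_mod_cast congrArg (Int.cast : ℤ → ℂ) hk
  rw [quadraticPhase, hk', Complex.exp_eq_exp_iff_exists_int]
  refine ⟨j * k + N' * k ^ 2, ?_⟩
  have hN'' : (N' : ℂ) = N / 2 := by rw [hN']; push_cast; ring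
  push_cast
  rw [hN'']
  field_simp
  ring

theorem quadraticPhase_add {N : ℕ} [NeZero N] (hN : Even N) (c d : ZMod N) :
    quadraticPhase N (c + d) =
      quadraticPhase N c * quadraticPhase N d * ZMod.stdAddChar (c * d) := by
  obtain ⟨c, rfl⟩ := ZMod.intCast_surjective c
  obtain ⟨d, rfl⟩ := ZMod.intCast_surjective d
  rw [← Int.cast_add, ← Int.cast_mul, quadraticPhase_intCast hN, quadraticPhase_intCast hN,
    quadraticPhase_intCast hN, ZMod.stdAddChar_coe, ← Complex.exp_add, ← Complex.exp_add]
  push_cast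
  ring_nf

theorem sum_quadraticPhase (N : ℕ) [NeZero N] (hN : Even N) :
    ∑ c, quadraticPhase N c = Real.sqrt N * Complex.exp (Real.pi * Complex.I / 4) := by
  rw [← sum_fin_exp_pi_mul_sq_div N hN]
  obtain ⟨n, rfl⟩ := Nat.exists_eq_succ_of_ne_zero (NeZero.ne N)
  rfl

/-- The rank of a positive definite even unimodular lattice is divisible by `8`. -/
theorem eight_dvd_finrank_of_even_unimodular {V : Type*} [AddCommGroup V] [Module ℚ V]
    [FiniteDimensional ℚ V] (b : LinearMap.BilinForm ℚ V) (symm : ∀ x y, b x y = b y x)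
    (pos : ∀ x, x ≠ 0 → 0 < b x x) (L : AddSubgroup V)
    (spanning : ∀ x, ∃ k : ℤ, k ≠ 0 ∧ k • x ∈ L) (even : ∀ x ∈ L, ∃ m : ℤ, b x x = 2 * m)
    (selfDual : ∀ y, (∀ x ∈ L, ∃ m : ℤ, b y x = m) → y ∈ L) :
    8 ∣ Module.finrank ℚ V := by
  classical
  have integral : ∀ x ∈ L, ∀ y ∈ L, ∃ m : ℤ, b x y = m := by
    intro x hx y hy
    obtain ⟨m, hm⟩ := even _ (L.add_mem hx hy)
    obtain ⟨m₁, hm₁⟩ := even x hx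
    obtain ⟨m₂, hm₂⟩ := even y hy
    refine ⟨m - m₁ - m₂, ?_⟩
    have := symm x y
    simp only [map_add, LinearMap.add_apply] at hm
    push_cast
    linarith
  have : Invertible (2 : ℚ) := invertibleOfNonzero two_ne_zero
  obtain ⟨n, hn, v, hv⟩ : ∃ n, Module.finrank ℚ V = n ∧
      ∃ v : Module.Basis (Fin n) ℚ V, ∀ i j, i ≠ j → b (v i) (v j) = 0 := by
    obtain ⟨v, hv⟩ := LinearMap.BilinForm.exists_orthogonal_basis (B := b) ⟨symm⟩
    exact ⟨_, rfl, v, fun i j hij => hv hij⟩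
  rw [hn]
  choose k hk hkL using fun i => spanning (v i)
  have hkq (i) : IsUnit ((k i : ℚ)) := isUnit_iff_ne_zero.mpr (by exact_mod_cast hk i)
  obtain ⟨w, hw⟩ : ∃ w : Module.Basis (Fin n) ℚ V, ∀ i, w i = (k i : ℚ) • v i :=
    ⟨v.isUnitSMul hkq, fun i => v.isUnitSMul_apply hkq i⟩
  have hwL (i) : w i ∈ L := by rw [hw, Int.cast_smul_eq_zsmul]; exact hkL i
  have hortho (i j) (hij : i ≠ j) : b (w i) (w j) = 0 := by
    simp [hw, hv i j hij]
  have exists_norm (i) : ∃ a : ℕ, 0 < a ∧ b (w i) (w i) = 2 * a := by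
    obtain ⟨m, hm⟩ := even _ (hwL i)
    have hpos := pos _ (w.ne_zero i)
    have hmpos : 0 < m := by
      rw [hm] at hpos
      exact_mod_cast (pos_of_mul_pos_right hpos zero_le_two)
    lift m to ℕ using hmpos.le
    exact ⟨m, by exact_mod_cast hmpos, by simpa using hm⟩
  choose a ha hwa using exists_norm
  let N : Fin n → ℕ := fun i => 2 * a i
  have hNpos (i) : 0 < N i := Nat.mul_pos two_pos (ha i)
  have instNeZero (i) : NeZero (N i) := ⟨(hNpos i).ne'⟩
  have hNq (i) : (N i : ℚ) ≠ 0 := by exact_mod_cast (hNpos i).ne'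
  have hwN (i) : b (w i) (w i) = N i := by rw [hwa]; simp [N]
  have hNeven (i) : Even (N i) := even_two_mul _
  let y : (Fin n → ℤ) →+ V :=
    { toFun := fun c => ∑ i, ((c i : ℚ) / N i) • w i
      map_zero' := by simp
      map_add' := fun c d => by
        simp [add_div, add_smul, Finset.sum_add_distrib] }
  have y_apply (c) : y c = ∑ i, ((c i : ℚ) / N i) • w i := rfl
  have b_y (c d) : b (y c) (y d) = ∑ i, (c i * d i : ℚ) / N i := by
    simp only [y_apply, map_sum, LinearMap.sum_apply, map_smul, LinearMap.smul_apply, smul_eq_mul]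
    refine Finset.sum_congr rfl fun i _ => ?_
    rw [Finset.sum_eq_single i (fun j _ hj => by simp [hortho _ _ hj]) (by simp), hwN]
    have := hNq i
    field_simp
  have exists_coord : ∀ x ∈ L, ∃ c, y c = x := by
    intro x hx
    choose c hc using fun i => integral x hx (w i) (hwL i)
    refine ⟨c, ?_⟩
    rw [y_apply, ← w.sum_repr x]
    refine Finset.sum_congr rfl fun i _ => ?_
    congr 1
    rw [← hc i]
    conv_lhs => rw [← w.sum_repr x]
    simp only [map_sum, LinearMap.sum_apply, map_smul, LinearMap.smul_apply, smul_eq_mul]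
    rw [Finset.sum_eq_single i (fun j _ hj => by simp [hortho _ _ hj]) (by simp), hwN]
    have := hNq i
    field_simp
  let red : (Fin n → ℤ) →+ (∀ i, ZMod (N i)) :=
    { toFun := fun c i => (c i : ZMod (N i))
      map_zero' := by ext; simp
      map_add' := fun c d => by ext; simp }
  have red_apply (c i) : red c i = (c i : ZMod (N i)) := rfl
  have red_surj (c) : ∃ c', red c' = c := by
    choose c' hc' using fun i => ZMod.intCast_surjective (c i)
    exact ⟨c', funext hc'⟩
  have mem_of_red (c d) (h : red c = red d) (hd : y d ∈ L) : y c ∈ L := by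
    have : ∀ i, ∃ m : ℤ, c i = d i + N i * m := fun i => by
      have := congrFun h i
      rw [red_apply, red_apply, ZMod.intCast_eq_intCast_iff_dvd_sub] at this
      obtain ⟨m, hm⟩ := this
      exact ⟨-m, by linarith⟩
    choose m hm using this
    have : y c = y d + ∑ i, m i • w i := by
      rw [y_apply, y_apply, ← Finset.sum_add_distrib]
      refine Finset.sum_congr rfl fun i _ => ?_
      rw [← Int.cast_smul_eq_zsmul ℚ, ← add_smul, hm]
      congr 1
      have := hNq i
      push_cast
      field_simp
    rw [this]
    exact L.add_mem hd (L.sum_mem fun i _ => L.zsmul_mem (hwL i) _)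
  let χ : (∀ i, ZMod (N i)) → ℂ := fun c => ∏ i, quadraticPhase (N i) (c i)
  let ψ : (∀ i, ZMod (N i)) → AddChar (∀ i, ZMod (N i)) ℂ := fun c =>
    { toFun := fun d => ∏ i, ZMod.stdAddChar (c i * d i)
      map_zero_eq_one' := by simp
      map_add_eq_mul' := fun d e => by
        simp [mul_add, AddChar.map_add_eq_mul, Finset.prod_mul_distrib] }
  have χ_red (c) : χ (red c) = Complex.exp (Real.pi * Complex.I * (b (y c) (y c) : ℚ)) := by
    simp only [χ, red_apply, quadraticPhase_intCast (hNeven _)]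
    rw [← Complex.exp_sum, b_y]
    push_cast
    rw [Finset.mul_sum]
    congr 1
    refine Finset.sum_congr rfl fun i _ => ?_
    ring
  have ψ_red (c d) : ψ (red c) (red d) =
      Complex.exp (2 * Real.pi * Complex.I * (b (y c) (y d) : ℚ)) := by
    change ∏ i, ZMod.stdAddChar (((c i : ℤ) : ZMod (N i)) * ((d i : ℤ) : ZMod (N i))) = _
    simp only [← Int.cast_mul, ZMod.stdAddChar_coe]
    rw [← Complex.exp_sum, b_y]
    push_cast
    rw [Finset.mul_sum]
    congr 1
    refine Finset.sum_congr rfl fun i _ => ?_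
    ring
  have gauss := sum_quadratic_eq_card χ ψ
    (fun c d => by
      change ∏ i, quadraticPhase (N i) (c i + d i) = (∏ i, quadraticPhase (N i) (c i)) *
        (∏ i, quadraticPhase (N i) (d i)) * ∏ i, ZMod.stdAddChar (c i * d i)
      rw [← Finset.prod_mul_distrib, ← Finset.prod_mul_distrib]
      exact Finset.prod_congr rfl fun i _ => quadraticPhase_add (hNeven i) _ _)
    ((L.comap y).map red)
    (by
      rintro _ ⟨c, hc, rfl⟩
      obtain ⟨m, hm⟩ := even _ hc
      rw [χ_red, hm, Complex.exp_eq_one_iff]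
      exact ⟨m, by push_cast; ring⟩)
    (by
      intro c hc
      obtain ⟨c, rfl⟩ := red_surj c
      refine ⟨c, selfDual _ fun x hx => ?_, rfl⟩
      obtain ⟨d, rfl⟩ := exists_coord x hx
      have := hc (red d) ⟨d, hx, rfl⟩
      rw [ψ_red, Complex.exp_eq_one_iff] at this
      obtain ⟨m, hm⟩ := this
      refine ⟨m, ?_⟩
      have hne : (2 * Real.pi * Complex.I : ℂ) ≠ 0 := Complex.two_pi_I_ne_zero
      rw [mul_comm (m : ℂ)] at hm
      exact_mod_cast mul_left_cancel₀ hne hm)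
  have product : ∑ c, χ c =
      ((∏ i, Real.sqrt (N i) : ℝ) : ℂ) * Complex.exp (Real.pi * Complex.I / 4) ^ n := by
    simp only [χ]
    rw [← Fintype.piFinset_univ, ← Finset.prod_univ_sum]
    simp only [sum_quadraticPhase _ (hNeven _)]
    rw [Finset.prod_mul_distrib, Finset.prod_const, Finset.card_univ, Fintype.card_fin]
    push_cast
    rfl
  rw [product] at gauss
  have rpos : 0 < ∏ i, Real.sqrt (N i) :=
    Finset.prod_pos fun i _ => Real.sqrt_pos.mpr (by exact_mod_cast hNpos i)
  have norm_exp : ‖Complex.exp (Real.pi * Complex.I / 4)‖ = 1 := by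
    rw [show (Real.pi * Complex.I / 4 : ℂ) = ((Real.pi / 4 : ℝ) : ℂ) * Complex.I by
      push_cast; ring]
    exact Complex.norm_exp_ofReal_mul_I _
  have norm_eq := congrArg norm gauss
  rw [norm_mul, norm_pow, norm_exp, one_pow, mul_one, Complex.norm_real,
    Real.norm_of_nonneg rpos.le, Complex.norm_natCast] at norm_eq
  rw [← Complex.ofReal_natCast, ← norm_eq] at gauss
  have root : Complex.exp (Real.pi * Complex.I / 4) ^ n = 1 :=
    mul_left_cancel₀ (by exact_mod_cast rpos.ne') (gauss.trans (mul_one _).symm)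
  rw [← Complex.exp_nat_mul, Complex.exp_eq_one_iff] at root
  obtain ⟨m, hm⟩ := root
  have hne : (Real.pi * Complex.I : ℂ) ≠ 0 := by simp [Real.pi_ne_zero]
  have : (n : ℂ) = 8 * m := by
    apply mul_left_cancel₀ hne
    linear_combination 4 * hm
  have : (n : ℤ) = 8 * m := by exact_mod_cast this
  omega

theorem exists_sum_sq_eq_sum_sq_add_two_mul {R ι : Type*} [CommRing R] (s : Finset ι) (f : ι → R) :
    ∃ g, (∑ i ∈ s, f i) ^ 2 = ∑ i ∈ s, f i ^ 2 + 2 * g := by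
  classical
  induction s using Finset.induction_on with
  | empty => exact ⟨0, by simp⟩
  | insert i s hi ih =>
    obtain ⟨g, hg⟩ := ih
    refine ⟨g + f i * ∑ j ∈ s, f j, ?_⟩
    rw [Finset.sum_insert hi, Finset.sum_insert hi]
    linear_combination hg

/-- The quadratic residues modulo `p`. -/
def quadraticResidues (p : ℕ) [Fact p.Prime] : Finset (ZMod p) :=
  Finset.univ.filter fun r => quadraticChar (ZMod p) r = 1

theorem mem_quadraticResidues {p : ℕ} [Fact p.Prime] {r : ZMod p} :
    r ∈ quadraticResidues p ↔ quadraticChar (ZMod p) r = 1 := by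
  simp [quadraticResidues]

theorem sum_quadraticResidues_two_mul {p : ℕ} [Fact p.Prime] (hp8 : p % 8 = 7) {M : Type*}
    [AddCommMonoid M] (f : ZMod p → M) :
    ∑ r ∈ quadraticResidues p, f (2 * r) = ∑ r ∈ quadraticResidues p, f r := by
  have two_ne : (2 : ZMod p) ≠ 0 := by
    intro h
    have : p ∣ 2 := (ZMod.natCast_eq_zero_iff 2 p).mp (by exact_mod_cast h)
    have := Nat.le_of_dvd two_pos this
    omega
  have two_sq : quadraticChar (ZMod p) 2 = 1 := by
    rw [quadraticChar_one_iff_isSquare two_ne, ZMod.exists_sq_eq_two_iff (by omega)]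
    exact Or.inr hp8
  refine Finset.sum_bijective (2 * ·) (mulLeft_bijective₀ 2 two_ne) (fun r => ?_) fun _ _ => rfl
  simp only [mem_quadraticResidues, map_mul, two_sq, one_mul]

theorem sum_zmod_eq_sum_quadraticResidues {p : ℕ} [Fact p.Prime] (hp4 : p % 4 = 3) {M : Type*}
    [AddCommMonoid M] (f : ZMod p → M) :
    ∑ r, f r = f 0 + (∑ r ∈ quadraticResidues p, f r + ∑ r ∈ quadraticResidues p, f (-r)) := by
  classical
  have neg_one : quadraticChar (ZMod p) (-1) = -1 := by
    rw [quadraticChar_neg_one_iff_not_isSquare, ZMod.exists_sq_eq_neg_one_iff]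
    simpa using hp4
  have neg_sum : ∑ r ∈ quadraticResidues p, f (-r) =
      ∑ r ∈ Finset.univ.filter (fun r => quadraticChar (ZMod p) r = -1), f r := by
    refine Finset.sum_bijective (- ·) neg_involutive.bijective (fun r => ?_) fun _ _ => rfl
    rw [mem_quadraticResidues, Finset.mem_filter, neg_eq_neg_one_mul r, map_mul, neg_one]
    simp
  rw [neg_sum, ← Finset.add_sum_erase _ _ (Finset.mem_univ (0 : ZMod p)), ← Finset.sum_union]
  · congr 2
    ext r
    simp only [Finset.mem_erase, Finset.mem_univ, and_true, Finset.mem_union,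
      mem_quadraticResidues, Finset.mem_filter, true_and]
    constructor
    · exact quadraticChar_dichotomy
    · rintro (h | h) rfl <;> simp at h
  · rw [Finset.disjoint_left]
    intro r hr hr'
    rw [mem_quadraticResidues] at hr
    rw [Finset.mem_filter, hr] at hr'
    exact absurd hr'.2 (by decide)

/-- In a unimodular lattice with an isometry of order `2p`, the fixed space of the `p`-th
power of the isometry contains an even unimodular lattice; hence its dimension is divisible
by `8`. -/
theorem eight_dvd_finrank_ker_pow_sub_one {p : ℕ} [Fact p.Prime] (hp8 : p % 8 = 7) {W : Type*}
    [AddCommGroup W] [Module ℚ W] [FiniteDimensional ℚ W] (b : LinearMap.BilinForm ℚ W)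
    (symm : ∀ x y, b x y = b y x) (pos : ∀ x, x ≠ 0 → 0 < b x x) (L : AddSubgroup W)
    (spanning : ∀ x, ∃ k : ℤ, k ≠ 0 ∧ k • x ∈ L)
    (integral : ∀ x ∈ L, ∀ y ∈ L, ∃ m : ℤ, b x y = m)
    (selfDual : ∀ y, (∀ x ∈ L, ∃ m : ℤ, b y x = m) → y ∈ L) (T : Module.End ℚ W)
    (isometry : ∀ x y, b (T x) (T y) = b x y) (map_mem : ∀ x ∈ L, T x ∈ L)
    (pow_eq_one : T ^ (2 * p) = 1) (eq_zero_of_fixed : ∀ x, T x = x → x = 0) :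
    8 ∣ Module.finrank ℚ (LinearMap.ker (T ^ p - 1)) := by
  let U := LinearMap.ker (T ^ p - 1)
  have mem_U (x) : x ∈ U ↔ (T ^ p) x = x := by simp [U, sub_eq_zero]
  have pow_isometry (n : ℕ) (x y) : b ((T ^ n) x) ((T ^ n) y) = b x y := by
    induction n with
    | zero => simp
    | succ n ih => rw [pow_succ', Module.End.mul_apply, Module.End.mul_apply, isometry, ih]
  have aeval_mem (g : ℤ[X]) : ∀ x ∈ L, aeval T g x ∈ L := by
    induction g using Polynomial.induction_on with
    | C a =>
      intro x hx
      simpa [Module.algebraMap_end_apply] using L.zsmul_mem hx a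
    | add f g hf hg =>
      intro x hx
      simpa using L.add_mem (hf x hx) (hg x hx)
    | monomial n a h =>
      intro x hx
      have := map_mem _ (h x hx)
      rw [pow_succ', mul_left_comm]
      simpa using this
  have aeval_mem_U (g : ℤ[X]) : ∀ x ∈ U, aeval T g x ∈ U := by
    intro x hx
    rw [mem_U] at hx ⊢
    have hcomm : T ^ p * aeval T g = aeval T g * T ^ p := by
      have hT : T ^ p = aeval T (X ^ p : ℤ[X]) := by simp
      rw [hT, ← map_mul, mul_comm, map_mul]
    rw [← Module.End.mul_apply, hcomm, Module.End.mul_apply, hx]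
  have pow_val (n : ℕ) : ∀ x ∈ U, (T ^ n) x = (T ^ (n : ZMod p).val) x := by
    intro x hx
    rw [mem_U] at hx
    have hk (k : ℕ) : ((T ^ p) ^ k) x = x := by
      induction k with
      | zero => simp
      | succ k ih => rw [pow_succ, Module.End.mul_apply, hx, ih]
    conv_lhs => rw [← Nat.mod_add_div n p, pow_add, pow_mul, Module.End.mul_apply, hk]
    rw [ZMod.val_natCast]
  let e : ℤ[X] := ∑ r ∈ quadraticResidues p, X ^ r.val
  let e' : ℤ[X] := ∑ r ∈ quadraticResidues p, X ^ (-r).val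
  have e_apply (x) : aeval T e x = ∑ r ∈ quadraticResidues p, (T ^ r.val) x := by
    simp [e, LinearMap.sum_apply]
  have e'_apply (x) : aeval T e' x = ∑ r ∈ quadraticResidues p, (T ^ (-r).val) x := by
    simp [e', LinearMap.sum_apply]
  have adjoint : ∀ x ∈ U, ∀ y, b (aeval T e x) y = b x (aeval T e' y) := by
    intro x hx y
    rw [e_apply, e'_apply, map_sum, map_sum, LinearMap.sum_apply]
    refine Finset.sum_congr rfl fun r _ => ?_
    rw [← pow_isometry (-r).val, ← Module.End.mul_apply, ← pow_add, pow_val _ x hx]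
    simp
  have relation : ∀ x ∈ U, x + (aeval T e x + aeval T e' x) = 0 := by
    intro x hx
    apply eq_zero_of_fixed
    have hsum : x + (aeval T e x + aeval T e' x) = ∑ r : ZMod p, (T ^ r.val) x := by
      rw [sum_zmod_eq_sum_quadraticResidues (by omega), e_apply, e'_apply]
      simp
    rw [hsum, map_sum]
    refine Fintype.sum_equiv (Equiv.addRight 1) _ _ fun r => ?_
    rw [← Module.End.mul_apply, ← pow_succ', pow_val _ x hx]
    simp
  have idempotent : ∃ g : ℤ[X], ∀ x ∈ U,
      aeval T e (aeval T e x) = aeval T e x + aeval T g ((2 : ℤ) • x) := by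
    obtain ⟨g, hg⟩ := exists_sum_sq_eq_sum_sq_add_two_mul (quadraticResidues p)
      fun r => (X : ℤ[X]) ^ r.val
    refine ⟨g, fun x hx => ?_⟩
    have hsum : ∑ r ∈ quadraticResidues p, (T ^ (r.val * 2)) x = aeval T e x := by
      rw [e_apply, ← sum_quadraticResidues_two_mul hp8 fun r => (T ^ r.val) x]
      refine Finset.sum_congr rfl fun r _ => ?_
      rw [pow_val _ x hx]
      simp [mul_comm]
    calc aeval T e (aeval T e x) = aeval T ((∑ r ∈ quadraticResidues p, X ^ r.val) ^ 2) x := by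
          rw [sq, map_mul, Module.End.mul_apply]
      _ = _ := by
        rw [hg, ← hsum, two_mul, two_smul]
        simp [← pow_mul, LinearMap.sum_apply]
  obtain ⟨g, hg⟩ := idempotent
  -- the dual of `L ∩ U` in `U`
  let InDual : W → Prop := fun x => ∀ y ∈ L, y ∈ U → ∃ m : ℤ, b x y = m
  have inDual_of_mem : ∀ x ∈ L, InDual x := fun x hx y hy _ => integral x hx y hy
  have sum_mem (l) (hl : l ∈ L) : l + (T ^ p) l ∈ L ∧ l + (T ^ p) l ∈ U := by
    constructor
    · exact L.add_mem hl (by simpa using aeval_mem (X ^ p) l hl)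
    · rw [mem_U, map_add, ← Module.End.mul_apply, ← pow_add, ← two_mul, pow_eq_one,
        Module.End.one_apply, add_comm]
  have pair_sum (x) (hx : x ∈ U) (l) : b x (l + (T ^ p) l) = 2 * b x l := by
    rw [mem_U] at hx
    have := pow_isometry p x l
    rw [hx] at this
    rw [map_add, this]
    ring
  have two_smul_mem (x) (hx : x ∈ U) (hxD : InDual x) : (2 : ℤ) • x ∈ L := by
    refine selfDual _ fun l hl => ?_
    obtain ⟨m, hm⟩ := hxD _ (sum_mem l hl).1 (sum_mem l hl).2
    refine ⟨m, ?_⟩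
    rw [pair_sum x hx] at hm
    rw [← hm, map_zsmul, LinearMap.smul_apply, zsmul_eq_mul]
    norm_num
  have mem_of_bidual (y) (hy : y ∈ U) (h : ∀ x ∈ U, InDual x → ∃ m : ℤ, b y x = m) : y ∈ L := by
    refine selfDual _ fun l hl => ?_
    have hU : (1 / 2 : ℚ) • (l + (T ^ p) l) ∈ U := U.smul_mem _ (sum_mem l hl).2
    have hpair (x) (hx : x ∈ U) : b x ((1 / 2 : ℚ) • (l + (T ^ p) l)) = b x l := by
      rw [map_smul, pair_sum x hx, smul_eq_mul]
      ring
    rw [← hpair y hy]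
    refine h _ hU fun x hxL hxU => ?_
    rw [symm, hpair x hxU]
    exact integral x hxL l hl
  have pair_e' (x) (hx : InDual x) (y) (hy : y ∈ U) (hyL : aeval T e' y ∈ L) :
      ∃ m : ℤ, b x (aeval T e' y) = m := hx _ hyL (aeval_mem_U e' y hy)
  let M : AddSubgroup U :=
    { carrier := {x | InDual x ∧ aeval T e' (x : W) ∈ L}
      zero_mem' := ⟨inDual_of_mem _ L.zero_mem, by simp⟩
      add_mem' := by
        rintro x y ⟨hx, hxL⟩ ⟨hy, hyL⟩
        refine ⟨fun z hz hzU => ?_, by simpa using L.add_mem hxL hyL⟩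
        obtain ⟨m, hm⟩ := hx z hz hzU
        obtain ⟨m', hm'⟩ := hy z hz hzU
        exact ⟨m + m', by simp [hm, hm']⟩
      neg_mem' := by
        rintro x ⟨hx, hxL⟩
        refine ⟨fun z hz hzU => ?_, by simpa using hxL⟩
        obtain ⟨m, hm⟩ := hx z hz hzU
        exact ⟨-m, by simp [hm]⟩ }
  have mem_M_of_mem (x : U) (hx : (x : W) ∈ L) : x ∈ M :=
    ⟨inDual_of_mem _ hx, aeval_mem e' _ hx⟩
  refine eight_dvd_finrank_of_even_unimodular (V := U) (b.restrict U) (fun x y => symm _ _)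
    (fun x hx => pos _ (by simpa using hx)) M (fun x => ?_) (fun x hx => ?_) (fun y hy => ?_)
  · obtain ⟨k, hk, hkx⟩ := spanning x
    exact ⟨k, hk, mem_M_of_mem _ (by simpa using hkx)⟩
  · obtain ⟨m, hm⟩ := pair_e' _ hx.1 _ x.2 hx.2
    refine ⟨-m, ?_⟩
    have h1 := congrArg (b (x : W)) (relation _ x.2)
    have h2 := adjoint _ x.2 x
    rw [symm] at h2
    simp only [map_add, map_zero] at h1
    change b (x : W) x = _
    push_cast
    linarith
  · have hyD : InDual y := fun x hx hxU => hy ⟨x, hxU⟩ (mem_M_of_mem _ hx)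
    refine ⟨hyD, mem_of_bidual _ (aeval_mem_U e' _ y.2) fun x hxU hxD => ?_⟩
    rw [symm, ← adjoint x hxU, symm]
    refine hy ⟨aeval T e x, aeval_mem_U e x hxU⟩ ⟨fun z hzL hzU => ?_, ?_⟩
    · rw [adjoint x hxU]
      exact pair_e' x hxD z hzU (aeval_mem e' z hzL)
    · have h := relation _ (aeval_mem_U e x hxU)
      rw [hg x hxU] at h
      have h' : aeval T e' (aeval T e x) = -(aeval T e ((2 : ℤ) • x) + aeval T g ((2 : ℤ) • x)) := by
        rw [map_zsmul (aeval T e), two_smul, eq_neg_iff_add_eq_zero, ← h]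
        abel
      have h2x := two_smul_mem x hxU hxD
      change aeval T e' (aeval T e x) ∈ L
      rw [h']
      exact L.neg_mem (L.add_mem (aeval_mem e _ h2x) (aeval_mem g _ h2x))

theorem eq_one_of_isometry_of_sub_one_sq_eq_zero {W : Type*} [AddCommGroup W] [Module ℚ W]
    (b : LinearMap.BilinForm ℚ W) (pos : ∀ x, x ≠ 0 → 0 < b x x) (U : Module.End ℚ W)
    (isometry : ∀ x y, b (U x) (U y) = b x y) (unipotent : (U - 1) ^ 2 = 0) : U = 1 := by
  ext x
  obtain ⟨y, hy⟩ : ∃ y, U x = x + y := ⟨U x - x, by abel⟩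
  have hUy : U y = y := by
    have h := LinearMap.congr_fun unipotent x
    rw [sq, Module.End.mul_apply, LinearMap.sub_apply, LinearMap.sub_apply, hy] at h
    simpa [sub_eq_zero] using h
  have hyy : b y y = 0 := by
    have h := isometry x y
    rw [hy, hUy, map_add, LinearMap.add_apply] at h
    linarith
  have : y = 0 := by
    by_contra hne
    exact (pos y hne).ne' hyy
  simp [hy, this]

theorem finrank_ker_involution_sub_one {W : Type*} [AddCommGroup W] [Module ℚ W]
    [FiniteDimensional ℚ W] (S : Module.End ℚ W) (hS : S * S = 1) :
    2 * (Module.finrank ℚ (LinearMap.ker (S - 1)) : ℚ) =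
      LinearMap.trace ℚ W S + Module.finrank ℚ W := by
  have hSS (x : W) : S (S x) = x := LinearMap.congr_fun hS x
  have isProj : LinearMap.IsProj (LinearMap.ker (S - 1)) ((1 / 2 : ℚ) • (S + 1)) := by
    constructor
    · intro x
      rw [LinearMap.mem_ker]
      simp [hSS, add_comm]
    · intro x hx
      have hx : S x = x := by simpa [sub_eq_zero] using hx
      simp [hx, ← two_smul ℚ, smul_smul]
  rw [← isProj.trace, map_smul, map_add, LinearMap.trace_one, smul_eq_mul]
  ring

theorem cyclotomic_sq_mul_dvd (p : ℕ) (hp : p ≠ 0) (R : Type*) [CommRing R] :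
    cyclotomic p R ^ 2 * cyclotomic (2 * p) R ^ 2 ∣ (X ^ (2 * p) - 1) ^ 2 := by
  rw [← mul_pow]
  refine pow_dvd_pow_of_dvd ?_ 2
  rw [← prod_cyclotomic_eq_X_pow_sub_one (by omega : 0 < 2 * p),
    ← Finset.prod_pair (f := fun n => cyclotomic n R) (by omega : p ≠ 2 * p)]
  refine Finset.prod_dvd_prod_of_subset _ _ _ fun n hn => ?_
  rw [Nat.mem_divisors]
  rcases Finset.mem_insert.mp hn with rfl | hn
  · exact ⟨dvd_mul_left _ _, by omega⟩
  · rw [Finset.mem_singleton.mp hn]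
    exact ⟨dvd_rfl, by omega⟩

/-- The trace of the `p`-th power of a matrix whose characteristic polynomial is
`Φ_p ^ 2 * Φ_{2p} ^ 2` vanishes modulo `p`. -/
theorem dvd_trace_pow_of_charpoly_eq {p : ℕ} [hp : Fact p.Prime] (hp2 : p ≠ 2) {n : Type*}
    [Fintype n] [DecidableEq n] (T : Matrix n n ℤ)
    (charpoly_eq : T.charpoly = cyclotomic p ℤ ^ 2 * cyclotomic (2 * p) ℤ ^ 2) :
    (p : ℤ) ∣ (T ^ p).trace := by
  cases isEmpty_or_nonempty n
  · simp [Matrix.trace]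
  let f := Int.castRingHom (ZMod p)
  have hcyc : cyclotomic p (ZMod p) = (X - C 1) ^ (p - 1) := by
    have := cyclotomic_mul_prime_eq_pow_of_not_dvd (ZMod p) (p := p) (n := 1)
      (by simpa using hp.out.ne_one)
    simpa using this
  have hcyc2 : cyclotomic (2 * p) (ZMod p) = (X + C 1) ^ (p - 1) := by
    have := cyclotomic_mul_prime_eq_pow_of_not_dvd (ZMod p) (p := p) (n := 2)
      (fun h => hp2 ((Nat.prime_dvd_prime_iff_eq hp.out Nat.prime_two).mp h))
    simpa using this
  have trace_zero : (T.map f).trace = 0 := by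
    rw [Matrix.trace_eq_neg_charpoly_nextCoeff, Matrix.charpoly_map, charpoly_eq]
    simp only [Polynomial.map_mul, Polynomial.map_pow, map_cyclotomic, hcyc, hcyc2]
    have h1 := monic_X_sub_C (1 : ZMod p)
    have h2 := monic_X_add_C (1 : ZMod p)
    rw [((h1.pow _).pow _).nextCoeff_mul ((h2.pow _).pow _), (h1.pow _).nextCoeff_pow,
      (h2.pow _).nextCoeff_pow, h1.nextCoeff_pow, h2.nextCoeff_pow, nextCoeff_X_sub_C,
      nextCoeff_X_add_C]
    simp
  have h := ZMod.trace_pow_card (T.map f)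
  rw [trace_zero, zero_pow hp.out.ne_zero] at h
  rw [← ZMod.intCast_zmod_eq_zero_iff_dvd, ← h, ← Matrix.map_pow]
  simp [Matrix.trace, f]

theorem stmt_9 (p : ℕ) (hp : p.Prime) (hp8 : p % 8 = 7) :
    ¬ ∃ B T : Matrix (Fin (4 * (p - 1))) (Fin (4 * (p - 1))) ℤ,
      B.IsSymm ∧ (∀ i, Even (B i i)) ∧
      (∀ x : Fin (4 * (p - 1)) → ℤ, x ≠ 0 → 0 < x ⬝ᵥ B.mulVec x) ∧
      B.det = 1 ∧ Tᵀ * B * T = B ∧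
      T.charpoly = (cyclotomic p ℤ) ^ 2 * (cyclotomic (2 * p) ℤ) ^ 2 := by
  obtain ⟨n, hn⟩ : ∃ n, n = 4 * (p - 1) := ⟨_, rfl⟩
  rw [← hn]
  rintro ⟨B, T, hB, -, hpos, hdet, hT, hchar⟩
  have : Fact p.Prime := ⟨hp⟩
  let φ := Int.castRingHom ℚ
  let b : LinearMap.BilinForm ℚ (Fin n → ℚ) := Matrix.toBilin' (B.map φ)
  have b_apply (x y) : b x y = x ⬝ᵥ (B.map φ) *ᵥ y := Matrix.toBilin'_apply' _ _ _
  let ι : (Fin n → ℤ) →+ (Fin n → ℚ) :=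
    { toFun := fun c i => c i
      map_zero' := by ext; simp
      map_add' := fun c d => by ext; simp }
  have ι_eq (c) : ι c = φ ∘ c := rfl
  have mulVec_ι (M : Matrix (Fin n) (Fin n) ℤ) (c) : (M.map φ) *ᵥ ι c = ι (M *ᵥ c) := by
    ext i
    exact (RingHom.map_mulVec φ M c i).symm
  have b_ι (c d) : b (ι c) (ι d) = ((c ⬝ᵥ B *ᵥ d : ℤ) : ℚ) := by
    rw [b_apply, mulVec_ι]
    exact (RingHom.map_dotProduct φ c (B *ᵥ d)).symm
  have spanning (x) : ∃ k : ℤ, k ≠ 0 ∧ k • x ∈ ι.range := by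
    refine ⟨∏ i, ((x i).den : ℤ), Finset.prod_ne_zero_iff.mpr fun i _ => by simp, ?_⟩
    have hdvd (i) : ((x i).den : ℤ) ∣ ∏ j, ((x j).den : ℤ) :=
      Finset.dvd_prod_of_mem _ (Finset.mem_univ i)
    choose q hq using hdvd
    refine ⟨fun i => q i * (x i).num, funext fun i => ?_⟩
    change ((q i * (x i).num : ℤ) : ℚ) = (∏ j, ((x j).den : ℤ)) • x i
    rw [hq i, zsmul_eq_mul]
    have := Rat.mul_den_eq_num (x i)
    push_cast
    linear_combination -(q i : ℚ) * this
  have symm (x y) : b x y = b y x := by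
    have hB' : (B.map φ)ᵀ = B.map φ := by rw [← Matrix.transpose_map, hB.eq]
    rw [b_apply, b_apply, dotProduct_comm, ← Matrix.vecMul_transpose, hB', dotProduct_mulVec]
  have pos (x) (hx : x ≠ 0) : 0 < b x x := by
    obtain ⟨k, hk, c, hc⟩ := spanning x
    have hc0 : c ≠ 0 := by
      rintro rfl
      rw [map_zero] at hc
      exact (smul_ne_zero hk hx) hc.symm
    have h : 0 < b (ι c) (ι c) := by rw [b_ι]; exact_mod_cast hpos c hc0
    rw [hc, map_zsmul, map_zsmul b, LinearMap.smul_apply, zsmul_eq_mul, zsmul_eq_mul,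
      ← mul_assoc] at h
    exact pos_of_mul_pos_right h (mul_self_nonneg _)
  have integral : ∀ x ∈ ι.range, ∀ y ∈ ι.range, ∃ m : ℤ, b x y = m := by
    rintro _ ⟨c, rfl⟩ _ ⟨d, rfl⟩
    exact ⟨_, b_ι c d⟩
  have selfDual (y) (hy : ∀ x ∈ ι.range, ∃ m : ℤ, b y x = m) : y ∈ ι.range := by
    choose m hm using fun i => hy (ι (Pi.single i 1)) ⟨_, rfl⟩
    have hBy : B.map φ *ᵥ y = ι m := by
      ext i
      have h := hm i
      have hsingle : ι (Pi.single i 1) = Pi.single i 1 := by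
        ext j
        rcases eq_or_ne j i with rfl | hj <;> simp [ι, *]
      rw [symm, b_apply, hsingle, single_one_dotProduct] at h
      exact h
    refine ⟨B.adjugate *ᵥ m, ?_⟩
    rw [← mulVec_ι, ← hBy, Matrix.mulVec_mulVec, ← Matrix.map_mul, Matrix.adjugate_mul, hdet]
    simp
  let f : Module.End ℚ (Fin n → ℚ) := Matrix.toLin' (T.map φ)
  have f_apply (x) : f x = T.map φ *ᵥ x := Matrix.toLin'_apply _ _
  have isometry (x y) : b (f x) (f y) = b x y := by
    rw [b_apply, b_apply, f_apply, f_apply, ← Matrix.vecMul_transpose, Matrix.mulVec_mulVec,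
      ← dotProduct_mulVec, Matrix.mulVec_mulVec]
    rw [← Matrix.transpose_map, ← Matrix.map_mul, ← Matrix.map_mul, ← mul_assoc, hT]
  have pow_isometry (k : ℕ) (x y) : b ((f ^ k) x) ((f ^ k) y) = b x y := by
    induction k with
    | zero => simp
    | succ k ih => rw [pow_succ', Module.End.mul_apply, Module.End.mul_apply, isometry, ih]
  have map_mem : ∀ x ∈ ι.range, f x ∈ ι.range := by
    rintro _ ⟨c, rfl⟩
    exact ⟨T *ᵥ c, by rw [f_apply, mulVec_ι]⟩
  have f_charpoly : f.charpoly = cyclotomic p ℚ ^ 2 * cyclotomic (2 * p) ℚ ^ 2 := by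
    rw [Matrix.charpoly_toLin', Matrix.charpoly_map, hchar]
    simp
  have cayley : aeval f (cyclotomic p ℚ ^ 2 * cyclotomic (2 * p) ℚ ^ 2) = 0 :=
    f_charpoly ▸ LinearMap.aeval_self_charpoly f
  have pow_eq_one : f ^ (2 * p) = 1 := by
    refine eq_one_of_isometry_of_sub_one_sq_eq_zero b pos _ (pow_isometry _) ?_
    obtain ⟨q, hq⟩ := cyclotomic_sq_mul_dvd p hp.ne_zero ℚ
    have := congrArg (aeval f) hq
    rw [map_mul, cayley, zero_mul] at this
    simpa using this
  have eq_zero_of_fixed (x) (hx : f x = x) : x = 0 := by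
    by_contra hne
    have hvec : f.HasEigenvector 1 x := ⟨Module.End.mem_eigenspace_iff.mpr (by simpa using hx), hne⟩
    have h := Module.End.aeval_apply_of_hasEigenvector
      (p := cyclotomic p ℚ ^ 2 * cyclotomic (2 * p) ℚ ^ 2) hvec
    rw [cayley, LinearMap.zero_apply, eq_comm, smul_eq_zero_iff_left hne, eval_mul, eval_pow,
      eval_pow] at h
    have h1 : 0 < eval 1 (cyclotomic p ℚ) := cyclotomic_pos (by omega) 1
    have h2 : 0 < eval 1 (cyclotomic (2 * p) ℚ) := cyclotomic_pos (by omega) 1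
    have : 0 < eval 1 (cyclotomic p ℚ) ^ 2 * eval 1 (cyclotomic (2 * p) ℚ) ^ 2 := by positivity
    exact this.ne' h
  have eight_dvd := eight_dvd_finrank_ker_pow_sub_one hp8 b symm pos ι.range spanning integral
    selfDual f isometry map_mem pow_eq_one eq_zero_of_fixed
  have dim := finrank_ker_involution_sub_one (f ^ p) (by rw [← pow_add, ← two_mul, pow_eq_one])
  have dim_le := Submodule.finrank_le (LinearMap.ker (f ^ p - 1))
  have trace_eq : LinearMap.trace ℚ _ (f ^ p) = ((T ^ p).trace : ℚ) := by
    rw [← Matrix.toLin'_pow, Matrix.trace_toLin'_eq, ← Matrix.map_pow]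
    simp [Matrix.trace, φ]
  obtain ⟨q, hq⟩ := dvd_trace_pow_of_charpoly_eq (p := p) (by omega) T hchar
  rw [trace_eq, hq, Module.finrank_fin_fun] at dim
  rw [Module.finrank_fin_fun] at dim_le
  obtain ⟨k, hk⟩ := eight_dvd
  rw [hk] at dim dim_le
  have dim : 2 * (8 * k : ℤ) = p * q + n := by exact_mod_cast dim
  obtain ⟨j, rfl⟩ : ∃ j, p = 8 * j + 7 := ⟨p / 8, by omega⟩
  have hn' : (n : ℤ) = 32 * j + 24 := by omega
  rw [hn'] at dim
  push_cast at dim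
  obtain ⟨c, rfl⟩ : ∃ c, q = 4 * c - 4 := by
    have : (4 : ℤ) ∣ q := by
      have : 4 * (2 * j * q + 2 * q - 4 * k + 8 * j + 6 : ℤ) = q := by linarith
      exact ⟨_, this.symm⟩
    obtain ⟨c, rfl⟩ := this
    exact ⟨c + 1, by ring⟩
  have h1 : (4 * k + 1 : ℤ) = (8 * j + 7) * c := by linarith
  have hk' : (4 * k : ℤ) ≤ 2 * (8 * j + 6) := by omega
  have c_pos : 0 < c := by
    by_contra hc
    nlinarith
  have c_le : c < 2 := by
    by_contra hc
    nlinarith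
  obtain rfl : c = 1 := by omega
  omega
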